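/- Ti₂(2 − √3) = (2/3)·G − (π/12)·log(2 + √3). -/

import Mathlib

open Real MeasureTheory intervalIntegral Finset

/-- Inverse tangent integral Ti₂(x) = ∫₀ˣ arctan u / u du. -/
noncomputable def Ti2 (x : ℝ) : ℝ := ∫ u in (0:ℝ)..x, Real.arctan u / u

/-- Catalan's constant G = Σ_{k≥0} (-1)^k/(2k+1)². -/
noncomputable def catalanG : ℝ := ∑' k : ℕ, (-1 : ℝ) ^ k / (2 * (k : ℝ) + 1) ^ 2

noncomputable def atq : ℝ → ℝ := dslope Real.arctan 0

lemma atq_ne {u : ℝ} (hu : u ≠ 0) : atq u = Real.arctan u / u := by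
  rw [atq, dslope_of_ne _ hu, slope_def_field]; simp

lemma atq_cont : Continuous atq := by
  rw [← continuousOn_univ, atq, continuousOn_dslope Filter.univ_mem]
  exact ⟨Real.continuous_arctan.continuousOn, Real.differentiable_arctan 0⟩

lemma Ti2_eq (x : ℝ) : Ti2 x = ∫ u in (0:ℝ)..x, atq u := by
  apply intervalIntegral.integral_congr_ae
  have : ∀ᵐ u : ℝ, u ≠ 0 := by simp [ae_iff]
  filter_upwards [this] with u hu _
  rw [atq_ne hu]

lemma Ti2_deriv (x : ℝ) : HasDerivAt Ti2 (atq x) x := by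
  have := (atq_cont.integral_hasStrictDerivAt 0 x).hasDerivAt
  rwa [← funext Ti2_eq] at this

noncomputable def SS (u : ℝ) : ℝ := Ti2 u - Real.arctan u * Real.log u

lemma SS_cont : Continuous SS := by
  have h1 : Continuous Ti2 := continuous_iff_continuousAt.2 fun x => (Ti2_deriv x).continuousAt
  have h2 : (fun u => Real.arctan u * Real.log u) = fun u => atq u * (u * Real.log u) := by
    funext u
    by_cases hu : u = 0
    · simp [hu]
    · rw [atq_ne hu]; field_simp
  have h3 : Continuous fun u => Real.arctan u * Real.log u := by
    rw [h2]; exact atq_cont.mul Real.continuous_mul_log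
  exact h1.sub h3

lemma SS_deriv {u : ℝ} (hu : 0 < u) : HasDerivAt SS (-Real.log u / (1 + u ^ 2)) u := by
  have := (Ti2_deriv u).sub ((Real.hasDerivAt_arctan u).mul (Real.hasDerivAt_log hu.ne'))
  refine this.congr_deriv ?_
  rw [atq_ne hu.ne']
  have : 1 + u ^ 2 ≠ 0 := by positivity
  field_simp
  ring

noncomputable def Ph (x : ℝ) : ℝ := SS (Real.tan x)

lemma Ph_deriv {x : ℝ} (h0 : 0 < x) (h1 : x < π / 2) :
    HasDerivAt Ph (-Real.log (Real.tan x)) x := by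
  have hc : 0 < Real.cos x := Real.cos_pos_of_mem_Ioo ⟨by linarith, h1⟩
  have := (SS_deriv (Real.tan_pos_of_pos_of_lt_pi_div_two h0 h1)).comp x
    (Real.hasDerivAt_tan hc.ne')
  refine this.congr_deriv ?_
  have e : (1 + Real.tan x ^ 2) * Real.cos x ^ 2 = 1 := by
    have h3 : Real.tan x * Real.cos x = Real.sin x := Real.tan_mul_cos hc.ne'
    have h4 := Real.sin_sq_add_cos_sq x
    rw [← h3] at h4
    linear_combination h4
  rw [div_mul_div_comm, e]
  simp

lemma Ph_cont {x : ℝ} (h0 : -(π / 2) < x) (h1 : x < π / 2) : ContinuousAt Ph x := by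
  have hc : 0 < Real.cos x := Real.cos_pos_of_mem_Ioo ⟨h0, h1⟩
  exact SS_cont.continuousAt.comp (Real.continuousAt_tan.2 hc.ne')

lemma Ph_symm : Ph (5 * π / 12) = Ph (π / 12) := by
  have hp := Real.pi_pos
  have key : ∀ x ∈ Set.Ioo (π/12) (π/4), HasDerivAt (fun x => Ph x - Ph (π / 2 - x)) 0 x := by
    rintro x ⟨h1, h2⟩
    have a := Ph_deriv (x := x) (by linarith) (by linarith)
    have b := (Ph_deriv (x := π / 2 - x) (by linarith) (by linarith)).comp x
      ((hasDerivAt_id x).const_sub (π / 2))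
    refine (a.sub b).congr_deriv ?_
    rw [Real.tan_pi_div_two_sub, Real.log_inv]; ring
  obtain ⟨c, -, hc⟩ := exists_hasDerivAt_eq_slope (fun x => Ph x - Ph (π / 2 - x)) (fun _ => 0)
    (a := π/12) (b := π/4) (by linarith) (by
      rintro x ⟨h1, h2⟩
      apply ContinuousAt.continuousWithinAt
      refine (Ph_cont (by linarith) (by linarith)).sub ?_
      exact ContinuousAt.comp (f := fun x => π / 2 - x) (Ph_cont (by linarith) (by linarith))
        (by fun_prop)) key
  have hd : π / 4 - π / 12 ≠ 0 := by linarith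
  rw [eq_div_iff hd] at hc
  rw [show π / 2 - π / 4 = π / 4 by ring, show π / 2 - π / 12 = 5 * π / 12 by ring] at hc
  linarith

lemma tan_triple {x : ℝ} (h0 : 0 < x) (h1 : x < π / 6) :
    Real.log (Real.tan (3 * x)) = Real.log (Real.tan x) + Real.log (Real.tan (π / 3 + x))
      + Real.log (Real.tan (π / 3 - x)) := by
  have hp := Real.pi_pos
  have t1 := Real.tan_pos_of_pos_of_lt_pi_div_two (x := x) (by linarith) (by linarith)
  have t2 := Real.tan_pos_of_pos_of_lt_pi_div_two (x := π / 3 + x) (by linarith) (by linarith)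
  have t3 := Real.tan_pos_of_pos_of_lt_pi_div_two (x := π / 3 - x) (by linarith) (by linarith)
  rw [← Real.log_mul t1.ne' t2.ne', ← Real.log_mul (mul_pos t1 t2).ne' t3.ne']
  congr 1
  have s3 : √3 ^ 2 = (3:ℝ) := Real.sq_sqrt (by norm_num)
  have hs : Real.sin (3 * x) = 4 * (Real.sin x * Real.sin (π / 3 + x) * Real.sin (π / 3 - x)) := by
    rw [Real.sin_three_mul, Real.sin_add, Real.sin_sub, Real.sin_pi_div_three,
      Real.cos_pi_div_three]
    have := Real.sin_sq_add_cos_sq x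
    linear_combination (-(Real.sin x) * Real.cos x ^ 2) * s3 - 3 * Real.sin x * this
  have hcc : Real.cos (3 * x) = 4 * (Real.cos x * Real.cos (π / 3 + x) * Real.cos (π / 3 - x)) := by
    rw [Real.cos_three_mul, Real.cos_add, Real.cos_sub, Real.sin_pi_div_three,
      Real.cos_pi_div_three]
    have := Real.sin_sq_add_cos_sq x
    linear_combination (Real.cos x * Real.sin x ^ 2) * s3 + 3 * Real.cos x * this
  simp only [Real.tan_eq_sin_div_cos]
  rw [hs, hcc, mul_div_mul_left _ _ (by norm_num)]
  simp only [mul_div_mul_comm]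

lemma Ph_zero : Ph 0 = 0 := by simp [Ph, SS, Ti2]

lemma Ph_triple : Ph (π / 12) = 2 / 3 * Ph (π / 4) := by
  have hp := Real.pi_pos
  obtain ⟨c, -, hc⟩ := exists_hasDerivAt_eq_slope
    (fun x => Ph (3 * x) / 3 - Ph x - Ph (π / 3 + x) + Ph (π / 3 - x)) (fun _ => 0)
    (a := 0) (b := π/12) (by linarith) (by
      rintro x ⟨h1, h2⟩
      apply ContinuousAt.continuousWithinAt
      have a1 : ContinuousAt (fun x => Ph (3 * x)) x :=
        ContinuousAt.comp (f := fun x => 3 * x) (Ph_cont (by linarith) (by linarith)) (by fun_prop)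
      have a2 : ContinuousAt (fun x => Ph (π / 3 + x)) x :=
        ContinuousAt.comp (f := fun x => π / 3 + x) (Ph_cont (by linarith) (by linarith))
          (by fun_prop)
      have a3 : ContinuousAt (fun x => Ph (π / 3 - x)) x :=
        ContinuousAt.comp (f := fun x => π / 3 - x) (Ph_cont (by linarith) (by linarith))
          (by fun_prop)
      exact (((a1.div_const 3).sub (Ph_cont (by linarith) (by linarith))).sub a2).add a3) (by
      rintro x ⟨h1, h2⟩
      have a := Ph_deriv (x := x) (by linarith) (by linarith)
      have a1 := (Ph_deriv (x := 3 * x) (by linarith) (by linarith)).comp x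
        ((hasDerivAt_id x).const_mul 3)
      have a2 := (Ph_deriv (x := π / 3 + x) (by linarith) (by linarith)).comp x
        ((hasDerivAt_id x).const_add (π / 3))
      have a3 := (Ph_deriv (x := π / 3 - x) (by linarith) (by linarith)).comp x
        ((hasDerivAt_id x).const_sub (π / 3))
      refine ((((a1.div_const 3).sub a).sub a2).add a3).congr_deriv ?_
      rw [tan_triple h1 (by linarith)]; ring)
  have hd : π / 12 - 0 ≠ 0 := by linarith
  rw [eq_div_iff hd] at hc
  rw [show 3 * (π / 12) = π / 4 by ring, show π / 3 + π / 12 = 5 * π / 12 by ring,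
    show π / 3 - π / 12 = π / 4 by ring, Ph_symm] at hc
  simp only [mul_zero, Ph_zero, add_zero, sub_zero] at hc
  linarith

lemma tan_pi12 : Real.tan (π / 12) = 2 - √3 := by
  have s3 : √3 ^ 2 = (3:ℝ) := Real.sq_sqrt (by norm_num)
  have s2 : √2 ^ 2 = (2:ℝ) := Real.sq_sqrt (by norm_num)
  have p2 : 0 < √2 := by positivity
  have p3 : 0 < √3 := by positivity
  rw [show π / 12 = π / 3 - π / 4 by ring, Real.tan_eq_sin_div_cos, Real.sin_sub, Real.cos_sub,
    Real.sin_pi_div_three, Real.cos_pi_div_three, Real.sin_pi_div_four, Real.cos_pi_div_four]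
  rw [div_eq_iff (by positivity)]
  linear_combination (√2 / 4) * s3

lemma Ti2_one : Ti2 1 = catalanG := by
  have hint : ∀ k : ℕ, ∫ u in Set.Ioc (0:ℝ) 1, u ^ (2 * k) / (2 * (k:ℝ) + 1)
      = 1 / (2 * (k : ℝ) + 1) ^ 2 := by
    intro k
    rw [← intervalIntegral.integral_of_le zero_le_one, intervalIntegral.integral_div, integral_pow]
    have : (2 * (k:ℝ) + 1) ≠ 0 := by positivity
    push_cast
    simp
    field_simp
  have H := MeasureTheory.hasSum_integral_of_summable_integral_norm
    (μ := volume.restrict (Set.Ioc (0:ℝ) 1))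
    (F := fun (k : ℕ) u => (-1 : ℝ) ^ k * (u ^ (2 * k) / (2 * (k:ℝ) + 1)))
    (by
      intro k
      have : Continuous fun u : ℝ => (-1 : ℝ) ^ k * (u ^ (2 * k) / (2 * (k:ℝ) + 1)) := by
        fun_prop
      exact this.integrableOn_Ioc)
    (by
      have : ∀ k : ℕ, ∫ u in Set.Ioc (0:ℝ) 1, ‖(-1 : ℝ) ^ k * (u ^ (2 * k) / (2 * (k:ℝ) + 1))‖
          = 1 / (2 * (k : ℝ) + 1) ^ 2 := by
        intro k
        rw [← hint k]
        congr 1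
        funext u
        have h1 : 0 ≤ u ^ (2 * k) / (2 * (k:ℝ) + 1) :=
          div_nonneg (by rw [pow_mul]; positivity) (by positivity)
        rw [norm_mul, norm_pow, norm_neg, norm_one, one_pow, one_mul, Real.norm_of_nonneg h1]
      simp only [this]
      have hs := (Real.summable_one_div_nat_pow (p := 2)).2 (by norm_num)
      have := hs.comp_injective (i := fun k : ℕ => 2 * k + 1) (fun a b h => by
        simp only at h; omega)
      refine this.congr fun k => ?_
      simp)
  rw [catalanG, Ti2, intervalIntegral.integral_of_le zero_le_one]
  have h2 : ∫ u in Set.Ioc (0:ℝ) 1, Real.arctan u / u = ∫ u in Set.Ioc (0:ℝ) 1,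
      ∑' k : ℕ, (-1 : ℝ) ^ k * (u ^ (2 * k) / (2 * (k:ℝ) + 1)) := by
    rw [integral_Ioc_eq_integral_Ioo, integral_Ioc_eq_integral_Ioo]
    refine setIntegral_congr_fun measurableSet_Ioo ?_
    rintro u ⟨h0, h1⟩
    have hu := (Real.hasSum_arctan (x := u) (by rw [Real.norm_of_nonneg h0.le]; exact h1)).div_const u
    simp only
    rw [← hu.tsum_eq]
    congr 1
    funext k
    push_cast
    have : (2 * (k:ℝ) + 1) ≠ 0 := by positivity
    field_simp
    ring
  rw [h2, ← H.tsum_eq]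
  congr 1
  funext k
  rw [MeasureTheory.integral_const_mul, hint k]
  ring

theorem stmt_9 :
    Ti2 (2 - Real.sqrt 3) = (2 / 3) * catalanG - (π / 12) * Real.log (2 + Real.sqrt 3) := by
  have hp := Real.pi_pos
  have h := Ph_triple
  have s3 : √3 ^ 2 = (3:ℝ) := Real.sq_sqrt (by norm_num)
  have p3 : 0 < √3 := by positivity
  have ha : Real.arctan (2 - √3) = π / 12 := by
    rw [← tan_pi12, Real.arctan_tan (by linarith) (by linarith)]
  have hl : Real.log (2 - √3) = - Real.log (2 + √3) := by
    rw [← Real.log_inv]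
    congr 1
    apply eq_inv_of_mul_eq_one_left
    linear_combination -s3
  rw [Ph, Ph, tan_pi12, Real.tan_pi_div_four, SS, SS, Real.log_one, ha, hl, Ti2_one] at h
  linarith
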